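/- arXiv:1912.06368 — 2 statements merged into one kernel-verified Lean document; each statement's English description precedes it below -/
import Mathlib

section
/- Let 𝔹 = (B, E, E^∨) be a reduced DK-triple, i.e. B = E^∨ ∘ E. Then the dual datum 𝔹^op := (B^op, (E^∨)^op, E^op) is again a DK-triple, and it is reduced. -/
open CategoryTheory CategoryTheory.Limits

universe v u v' u'

namespace DK

variable {B : Type u} [Category.{v} B]

/-- The singular arrows `Sing := E^∨_≠ ∘ B`: arrows of the form
(non-invertible dual Epi) ∘ (arbitrary arrow). -/
def Sing (Edual : MorphismProperty B) : MorphismProperty B :=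
  fun X Y f => ∃ (Z : B) (g : X ⟶ Z) (h : Z ⟶ Y), Edual h ∧ ¬ IsIso h ∧ f = g ≫ h

/-- The regular arrows `Reg := B ∖ Sing`. -/
def Regular (Edual : MorphismProperty B) : MorphismProperty B :=
  fun _ _ f => ¬ Sing Edual f

/-- The Monos `M := B ∖ (B ∘ E_≠)`: arrows which are not of the form
(arbitrary arrow) ∘ (non-invertible Epi). -/
def Mon (E : MorphismProperty B) : MorphismProperty B :=
  fun X Y f => ¬ ∃ (Z : B) (e : X ⟶ Z) (g : Z ⟶ Y), E e ∧ ¬ IsIso e ∧ f = e ≫ g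

/-- Two arrows out of `b` are isomorphic as objects of the category `E(b)` of
(Epis) under `b`. -/
def EpiEquiv {b c c' : B} (e : b ⟶ c) (e' : b ⟶ c') : Prop :=
  ∃ u : c ≅ c', e ≫ u.hom = e'

/-- Two arrows into `b` are isomorphic as objects of the category `E^∨(b)` of
(dual Epis) over `b`. -/
def DualEquiv {b c c' : B} (d : c ⟶ b) (d' : c' ⟶ b) : Prop :=
  ∃ u : c ≅ c', u.hom ≫ d' = d

/-- A (T1)-factorization of the arrow `f` as `e^∨ ∘ f̄ ∘ e` with `e ∈ E`,
`f̄ ∈ M ∩ Reg` and `e^∨ ∈ E^∨`. -/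
structure Fact (E Edual : MorphismProperty B) {X Y : B} (f : X ⟶ Y) where
  Z : B
  W : B
  e : X ⟶ Z
  m : Z ⟶ W
  d : W ⟶ Y
  he : E e
  hm : Mon E m ∧ Regular Edual m
  hd : Edual d
  fac : e ≫ m ≫ d = f

/-- Axiom (T2) at the object `b`: there are finitely many Epis out of `b` and
dual Epis into `b` up to isomorphism, and they can be enumerated by `Fin n`
(`n ≥ 1`) in such a way that the pairing matrix `⟨e_i ; e^∨_j⟩ = e_i ∘ e^∨_j`
has isomorphisms on the diagonal and non-isomorphisms below the diagonal. -/
def TriangularAt (E Edual : MorphismProperty B) (b : B) : Prop :=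
  ∃ n : ℕ, 0 < n ∧ ∃ (cE : Fin n → B) (eR : ∀ i, b ⟶ cE i)
      (cD : Fin n → B) (dR : ∀ i, cD i ⟶ b),
    (∀ i, E (eR i)) ∧ (∀ i, Edual (dR i)) ∧
    (∀ {c : B} (e : b ⟶ c), E e → ∃! i : Fin n, EpiEquiv e (eR i)) ∧
    (∀ {c : B} (d : c ⟶ b), Edual d → ∃! i : Fin n, DualEquiv d (dR i)) ∧
    (∀ i : Fin n, IsIso (dR i ≫ eR i)) ∧
    (∀ i j : Fin n, j < i → ¬ IsIso (dR j ≫ eR i))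

/-- The diagonalizable version of axiom (T2) at `b`: the pairing matrix has
isomorphisms on the diagonal and non-isomorphisms in all off-diagonal spots. -/
def DiagonalAt (E Edual : MorphismProperty B) (b : B) : Prop :=
  ∃ n : ℕ, 0 < n ∧ ∃ (cE : Fin n → B) (eR : ∀ i, b ⟶ cE i)
      (cD : Fin n → B) (dR : ∀ i, cD i ⟶ b),
    (∀ i, E (eR i)) ∧ (∀ i, Edual (dR i)) ∧
    (∀ {c : B} (e : b ⟶ c), E e → ∃! i : Fin n, EpiEquiv e (eR i)) ∧
    (∀ {c : B} (d : c ⟶ b), Edual d → ∃! i : Fin n, DualEquiv d (dR i)) ∧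
    (∀ i : Fin n, IsIso (dR i ≫ eR i)) ∧
    (∀ i j : Fin n, i ≠ j → ¬ IsIso (dR j ≫ eR i))

/-- A DK-triple `𝔹 = (B, E, E^∨)`: a category `B` with two wide subcategories
`E` (the Epis) and `E^∨` (the dual Epis), each containing all isomorphisms,
subject to the axioms (T1)–(T5). -/
structure DKTriple (B : Type u) [Category.{v} B] where
  /-- the Epis -/
  E : MorphismProperty B
  /-- the dual Epis -/
  Edual : MorphismProperty B
  E_iso : ∀ {X Y : B} (f : X ⟶ Y), IsIso f → E f
  Edual_iso : ∀ {X Y : B} (f : X ⟶ Y), IsIso f → Edual f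
  E_comp : ∀ {X Y Z : B} {f : X ⟶ Y} {g : Y ⟶ Z}, E f → E g → E (f ≫ g)
  Edual_comp : ∀ {X Y Z : B} {f : X ⟶ Y} {g : Y ⟶ Z}, Edual f → Edual g → Edual (f ≫ g)
  /-- (T1), existence part -/
  t1_exists : ∀ {X Y : B} (f : X ⟶ Y), Nonempty (Fact E Edual f)
  /-- (T1), uniqueness up to unique isomorphism -/
  t1_unique : ∀ {X Y : B} {f : X ⟶ Y} (F₁ F₂ : Fact E Edual f),
    ∃! p : (F₁.Z ≅ F₂.Z) × (F₁.W ≅ F₂.W),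
      F₁.e ≫ p.1.hom = F₂.e ∧ p.1.hom ≫ F₂.m = F₁.m ≫ p.2.hom ∧
        p.2.hom ≫ F₂.d = F₁.d
  /-- (T2) -/
  t2 : ∀ b : B, TriangularAt E Edual b
  /-- (T3): `E^∨ ∘ E` is closed under composition -/
  t3 : ∀ {X Y Z : B} {f : X ⟶ Y} {g : Y ⟶ Z},
    (∃ (W : B) (e : X ⟶ W) (d : W ⟶ Y), E e ∧ Edual d ∧ f = e ≫ d) →
    (∃ (W : B) (e : Y ⟶ W) (d : W ⟶ Z), E e ∧ Edual d ∧ g = e ≫ d) →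
    ∃ (W : B) (e : X ⟶ W) (d : W ⟶ Z), E e ∧ Edual d ∧ f ≫ g = e ≫ d
  /-- (T4): `(M ∩ Reg) ∘ (M ∩ Reg) ⊆ M` -/
  t4 : ∀ {X Y Z : B} {f : X ⟶ Y} {g : Y ⟶ Z},
    (Mon E f ∧ Regular Edual f) → (Mon E g ∧ Regular Edual g) → Mon E (f ≫ g)
  /-- (T5): `M ∘ Sing ⊆ Sing` -/
  t5 : ∀ {X Y Z : B} {f : X ⟶ Y} {g : Y ⟶ Z},
    Sing Edual f → Mon E g → Sing Edual (f ≫ g)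

/-- A DK-triple is *reduced* if `B = E^∨ ∘ E`. -/
def DKTriple.Reduced (T : DKTriple B) : Prop :=
  ∀ {X Y : B} (f : X ⟶ Y),
    ∃ (W : B) (e : X ⟶ W) (d : W ⟶ Y), T.E e ∧ T.Edual d ∧ f = e ≫ d

end DK

namespace DK

variable {B : Type u} [Category.{v} B]

namespace DKTriple

lemma isSplitEpi_of_E (T : DKTriple B) {X Y : B} {e : X ⟶ Y} (he : T.E e) : IsSplitEpi e := by
  obtain ⟨n, -, cE, eR, cD, dR, -, -, hE, -, hdiag, -⟩ := T.t2 X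
  obtain ⟨i, ⟨u, hu⟩, -⟩ := hE e he
  have := hdiag i
  refine ⟨⟨u.hom ≫ inv (dR i ≫ eR i) ≫ dR i, ?_⟩⟩
  rw [← cancel_mono u.hom]
  simp only [Category.assoc, hu, IsIso.inv_hom_id, Category.comp_id, Category.id_comp]

lemma isSplitMono_of_Edual (T : DKTriple B) {X Y : B} {d : X ⟶ Y} (hd : T.Edual d) :
    IsSplitMono d := by
  obtain ⟨n, -, cE, eR, cD, dR, -, -, -, hD, hdiag, -⟩ := T.t2 Y
  obtain ⟨i, ⟨u, hu⟩, -⟩ := hD d hd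
  have := hdiag i
  refine ⟨⟨eR i ≫ inv (dR i ≫ eR i) ≫ u.inv, ?_⟩⟩
  rw [← hu]
  have h := IsIso.hom_inv_id (dR i ≫ eR i)
  simp only [Category.assoc] at h ⊢
  rw [reassoc_of% h, Iso.hom_inv_id]

lemma isIso_left_of_E (T : DKTriple B) {X Y Z : B} {e : X ⟶ Y} {g : Y ⟶ Z} (he : T.E e)
    (h : IsIso (e ≫ g)) : IsIso e := by
  have := T.isSplitEpi_of_E he
  have : Mono e := mono_of_mono e g
  exact isIso_of_mono_of_isSplitEpi e

lemma isIso_right_of_Edual (T : DKTriple B) {X Y Z : B} {g : X ⟶ Y} {d : Y ⟶ Z}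
    (hd : T.Edual d) (h : IsIso (g ≫ d)) : IsIso d := by
  have := T.isSplitMono_of_Edual hd
  have : Epi d := epi_of_epi g d
  exact isIso_of_epi_of_isSplitMono d

lemma regular_of_isIso (T : DKTriple B) {X Y : B} (f : X ⟶ Y) [IsIso f] :
    Regular T.Edual f := by
  rintro ⟨Z, g, h, hh, hn, rfl⟩
  exact hn (T.isIso_right_of_Edual hh ‹_›)

/-- In a reduced DK-triple every regular arrow is an Epi. -/
lemma Reduced.E_of_regular {T : DKTriple B} (hred : T.Reduced) {X Y : B} {f : X ⟶ Y}
    (hf : Regular T.Edual f) : T.E f := by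
  obtain ⟨W, e, d, he, hd, rfl⟩ := hred f
  have : IsIso d := by
    by_contra hn
    exact hf ⟨W, e, d, hd, hn, rfl⟩
  exact T.E_comp he (T.E_iso d this)

/-- In a reduced DK-triple the regular Monos are isomorphisms. -/
lemma Reduced.isIso_of_mon_of_regular {T : DKTriple B} (hred : T.Reduced) {X Y : B} {f : X ⟶ Y}
    (hM : Mon T.E f) (hR : Regular T.Edual f) : IsIso f := by
  by_contra hn
  exact hM ⟨Y, f, 𝟙 Y, hred.E_of_regular hR, hn, (Category.comp_id f).symm⟩

end DKTriple

lemma sing_op_iff (E : MorphismProperty B) {X Y : Bᵒᵖ} (f : X ⟶ Y) :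
    Sing E.op f ↔ ∃ (Z : B) (e : Y.unop ⟶ Z) (g : Z ⟶ X.unop),
      E e ∧ ¬ IsIso e ∧ f.unop = e ≫ g := by
  constructor
  · rintro ⟨Z, g, h, hh, hn, rfl⟩
    exact ⟨Z.unop, h.unop, g.unop, hh, fun hi => hn ((isIso_unop_iff h).1 hi), rfl⟩
  · rintro ⟨Z, e, g, he, hn, h⟩
    exact ⟨.op Z, g.op, e.op, he, fun hi => hn ((isIso_op_iff e).1 hi), Quiver.Hom.unop_inj h⟩

lemma regular_op_iff (E : MorphismProperty B) {X Y : Bᵒᵖ} (f : X ⟶ Y) :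
    Regular E.op f ↔ Mon E f.unop :=
  not_congr (sing_op_iff E f)

lemma mon_op_iff (Edual : MorphismProperty B) {X Y : Bᵒᵖ} (f : X ⟶ Y) :
    Mon Edual.op f ↔ Regular Edual f.unop := by
  refine not_congr ⟨?_, ?_⟩
  · rintro ⟨Z, e, g, he, hn, rfl⟩
    exact ⟨Z.unop, g.unop, e.unop, he, fun hi => hn ((isIso_unop_iff e).1 hi), rfl⟩
  · rintro ⟨Z, g, h, hh, hn, hf⟩
    exact ⟨.op Z, h.op, g.op, hh, fun hi => hn ((isIso_op_iff h).1 hi), Quiver.Hom.unop_inj hf⟩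

/-- The factorization of `f.op` dual to a factorization of `f`. -/
def Fact.op {E Edual : MorphismProperty B} {X Y : B} {f : X ⟶ Y} (F : Fact E Edual f) :
    Fact Edual.op E.op f.op where
  Z := .op F.W
  W := .op F.Z
  e := F.d.op
  m := F.m.op
  d := F.e.op
  he := F.hd
  hm := ⟨(mon_op_iff Edual _).2 F.hm.2, (regular_op_iff E _).2 F.hm.1⟩
  hd := F.he
  fac := Quiver.Hom.unop_inj (by simpa using F.fac)

/-- The factorization of `f.unop` dual to a factorization of `f`. -/
def Fact.unop {E Edual : MorphismProperty B} {X Y : Bᵒᵖ} {f : X ⟶ Y}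
    (F : Fact Edual.op E.op f) : Fact E Edual f.unop where
  Z := F.W.unop
  W := F.Z.unop
  e := F.d.unop
  m := F.m.unop
  d := F.e.unop
  he := F.hd
  hm := ⟨(regular_op_iff E _).1 F.hm.2, (mon_op_iff Edual _).1 F.hm.1⟩
  hd := F.he
  fac := by simp [← F.fac]

lemma epiEquiv_op_iff {b c : Bᵒᵖ} {c' : B} (e : b ⟶ c) (d : c' ⟶ b.unop) :
    EpiEquiv e d.op ↔ DualEquiv e.unop d := by
  constructor
  · rintro ⟨u, hu⟩
    exact ⟨u.unop.symm, (Iso.inv_comp_eq u.unop).2 (congrArg Quiver.Hom.unop hu).symm⟩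
  · rintro ⟨u, hu⟩
    exact ⟨u.symm.op, Quiver.Hom.unop_inj ((Iso.inv_comp_eq u).2 hu.symm)⟩

lemma dualEquiv_op_iff {b c : Bᵒᵖ} {c' : B} (d : c ⟶ b) (e : b.unop ⟶ c') :
    DualEquiv d e.op ↔ EpiEquiv d.unop e := by
  constructor
  · rintro ⟨u, hu⟩
    exact ⟨u.unop.symm, (Iso.comp_inv_eq u.unop).2 (congrArg Quiver.Hom.unop hu).symm⟩
  · rintro ⟨u, hu⟩
    exact ⟨u.symm.op, Quiver.Hom.unop_inj ((Iso.comp_inv_eq u).2 hu.symm)⟩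

lemma TriangularAt.op {E Edual : MorphismProperty B} {b : B} (h : TriangularAt E Edual b) :
    TriangularAt Edual.op E.op (.op b) := by
  obtain ⟨n, hn, cE, eR, cD, dR, hE, hD, hEu, hDu, hdiag, htri⟩ := h
  refine ⟨n, hn, fun i => .op (cD i.rev), fun i => (dR i.rev).op, fun i => .op (cE i.rev),
    fun i => (eR i.rev).op, fun i => hD _, fun i => hE _, ?_, ?_, ?_, ?_⟩
  · intro c e he
    obtain ⟨i, hi, huniq⟩ := hDu e.unop he
    exact ⟨i.rev, (epiEquiv_op_iff _ _).2 (by rw [Fin.rev_rev]; exact hi),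
      fun j hj => Fin.rev_eq_iff.1 (huniq _ ((epiEquiv_op_iff _ _).1 hj))⟩
  · intro c d hd
    obtain ⟨i, hi, huniq⟩ := hEu d.unop hd
    exact ⟨i.rev, (dualEquiv_op_iff _ _).2 (by rw [Fin.rev_rev]; exact hi),
      fun j hj => Fin.rev_eq_iff.1 (huniq _ ((dualEquiv_op_iff _ _).1 hj))⟩
  · intro i
    rw [← op_comp, isIso_op_iff]
    exact hdiag _
  · intro i j hij
    rw [← op_comp, isIso_op_iff]
    exact htri _ _ (Fin.rev_lt_rev.2 hij)

/-- The dual `(Bᵒᵖ, (E^∨)ᵒᵖ, Eᵒᵖ)` of a reduced DK-triple. -/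
def DKTriple.Reduced.op {T : DKTriple B} (hred : T.Reduced) : DKTriple Bᵒᵖ where
  E := T.Edual.op
  Edual := T.E.op
  E_iso f _ := T.Edual_iso f.unop inferInstance
  Edual_iso f _ := T.E_iso f.unop inferInstance
  E_comp hf hg := T.Edual_comp hg hf
  Edual_comp hf hg := T.E_comp hg hf
  t1_exists f := (T.t1_exists f.unop).map Fact.op
  t1_unique F₁ F₂ := by
    obtain ⟨⟨p, q⟩, ⟨h₁, h₂, h₃⟩, huniq⟩ := T.t1_unique F₂.unop F₁.unop
    refine ⟨(q.op, p.op), ⟨Quiver.Hom.unop_inj h₃, Quiver.Hom.unop_inj h₂.symm,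
      Quiver.Hom.unop_inj h₁⟩, ?_⟩
    rintro ⟨p', q'⟩ ⟨h₁', h₂', h₃'⟩
    have h := huniq (q'.unop, p'.unop) ⟨congrArg Quiver.Hom.unop h₃',
      (congrArg Quiver.Hom.unop h₂').symm, congrArg Quiver.Hom.unop h₁'⟩
    rw [← (Prod.mk.inj h).1, ← (Prod.mk.inj h).2]
    rfl
  t2 b := (T.t2 b.unop).op
  t3 {X Y Z f g} _ _ := by
    obtain ⟨W, e, d, he, hd, h⟩ := hred (f ≫ g).unop
    exact ⟨.op W, d.op, e.op, hd, he, Quiver.Hom.unop_inj h⟩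
  t4 {X Y Z f g} hf hg := by
    have := hred.isIso_of_mon_of_regular ((regular_op_iff _ f).1 hf.2) ((mon_op_iff _ f).1 hf.1)
    have := hred.isIso_of_mon_of_regular ((regular_op_iff _ g).1 hg.2) ((mon_op_iff _ g).1 hg.1)
    rw [mon_op_iff, unop_comp]
    exact T.regular_of_isIso _
  t5 {X Y Z f g} hf hg := by
    rw [sing_op_iff] at hf ⊢
    obtain ⟨W, e, k, he, hn, h⟩ := hf
    have hgE := hred.E_of_regular ((mon_op_iff _ g).1 hg)
    refine ⟨W, g.unop ≫ e, k, T.E_comp hgE he, fun hi => ?_, by simp [h]⟩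
    have := T.isIso_left_of_E hgE hi
    exact hn (IsIso.of_isIso_comp_left g.unop e)

/-- For a reduced DK-triple `(B, E, E^∨)`, the dual datum
`(B^op, (E^∨)^op, E^op)` is again a DK-triple, and it is reduced. -/
theorem op_dkTriple_of_reduced (T : DKTriple B) (hred : T.Reduced) :
    ∃ T' : DKTriple Bᵒᵖ,
      (∀ {X Y : Bᵒᵖ} (f : X ⟶ Y), T'.E f ↔ T.Edual f.unop) ∧
      (∀ {X Y : Bᵒᵖ} (f : X ⟶ Y), T'.Edual f ↔ T.E f.unop) ∧
      T'.Reduced := by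
  refine ⟨hred.op, fun _ => Iff.rfl, fun _ => Iff.rfl, fun f => ?_⟩
  obtain ⟨W, e, d, he, hd, h⟩ := hred f.unop
  exact ⟨.op W, d.op, e.op, hd, he, Quiver.Hom.unop_inj h⟩

end DK
end

section
/- Let Δ be the simplex category (objects the ordinals [n] = {0 < 1 < … < n}, morphisms the weakly monotone maps), let E ⊆ Δ be the wide subcategory of surjective maps, and let E^∨_min ⊆ Δ be the wide subcategory of injective maps g with g(0) = 0 (minimum-preserving injections). Then 𝔹^Δ_min = (Δ, E, E^∨_min) is a DK-triple, i.e. it satisfies axioms (T1)–(T5). -/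
open CategoryTheory CategoryTheory.Limits

universe v u v' u'

namespace DK

namespace Simplex

open SimplexCategory

variable {X Y Z : SimplexCategory}

theorem isIso_iff_bijective (f : X ⟶ Y) : IsIso f ↔ Function.Bijective f.toOrderHom := by
  refine ⟨fun _ => ⟨mono_iff_injective.1 inferInstance, epi_iff_surjective.1 inferInstance⟩,
    fun h => isIso_of_bijective h⟩

theorem comp_apply (f : X ⟶ Y) (g : Y ⟶ Z) (x : Fin (X.len + 1)) :
    (f ≫ g).toOrderHom x = g.toOrderHom (f.toOrderHom x) := rfl

theorem hom_ext_apply {f g : X ⟶ Y} (h : ∀ x, f.toOrderHom x = g.toOrderHom x) : f = g :=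
  Hom.ext _ _ (OrderHom.ext _ _ (funext h))

theorem apply_eq_of_eq {f g : X ⟶ Y} (h : f = g) (x : Fin (X.len + 1)) :
    f.toOrderHom x = g.toOrderHom x := by rw [h]

theorem map_zero_of_surjective {f : X ⟶ Y} (hf : Function.Surjective f.toOrderHom) :
    f.toOrderHom 0 = 0 := by
  obtain ⟨x, hx⟩ := hf 0
  exact Fin.le_zero_iff.1 (hx ▸ f.toOrderHom.monotone (Fin.zero_le x))

/-- A map whose range is contained in that of an injection `g` factors through `g`. -/
theorem exists_lift (f : X ⟶ Z) (g : Y ⟶ Z) (hg : Function.Injective g.toOrderHom)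
    (h : ∀ x, ∃ y, g.toOrderHom y = f.toOrderHom x) : ∃ u : X ⟶ Y, u ≫ g = f := by
  choose u hu using h
  have hs : StrictMono g.toOrderHom := g.toOrderHom.monotone.strictMono_of_injective hg
  refine ⟨Hom.mk ⟨u, fun a b hab => ?_⟩, hom_ext_apply fun x => hu x⟩
  rw [← hs.le_iff_le, hu, hu]
  exact f.toOrderHom.monotone hab

/-- Injections with the same range are isomorphic over their target. -/
theorem exists_iso_of_range_eq (f : X ⟶ Z) (g : Y ⟶ Z) (hf : Function.Injective f.toOrderHom)
    (hg : Function.Injective g.toOrderHom)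
    (h : Set.range f.toOrderHom = Set.range g.toOrderHom) : ∃ u : X ≅ Y, u.hom ≫ g = f := by
  obtain ⟨u, hu⟩ := exists_lift f g hg fun x => h.le ⟨x, rfl⟩
  obtain ⟨v, hv⟩ := exists_lift g f hf fun x => h.ge ⟨x, rfl⟩
  have := mono_iff_injective.2 hf
  have := mono_iff_injective.2 hg
  refine ⟨⟨u, v, ?_, ?_⟩, hu⟩
  · rw [← cancel_mono f, Category.assoc, hv, hu, Category.id_comp]
  · rw [← cancel_mono g, Category.assoc, hu, hv, Category.id_comp]

/-- Factorizations of an arrow into a surjection and an injection are isomorphic. -/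
theorem exists_iso_of_comp_eq {W : SimplexCategory} {e : W ⟶ X} {i : X ⟶ Z} {e' : W ⟶ Y}
    {i' : Y ⟶ Z} (he : Function.Surjective e.toOrderHom) (hi : Function.Injective i.toOrderHom)
    (he' : Function.Surjective e'.toOrderHom) (hi' : Function.Injective i'.toOrderHom)
    (h : e ≫ i = e' ≫ i') : ∃ u : X ≅ Y, e ≫ u.hom = e' := by
  have hr : Set.range i.toOrderHom = Set.range i'.toOrderHom := by
    rw [← he.range_comp, ← he'.range_comp]
    exact congrArg Set.range (funext fun x => apply_eq_of_eq h x)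
  obtain ⟨u, hu⟩ := exists_iso_of_range_eq i i' hi hi' hr
  have := mono_iff_injective.2 hi'
  refine ⟨u, ?_⟩
  rw [← cancel_mono i', Category.assoc, hu, h]

/-- Every nonempty subset is the range of an injection. -/
theorem exists_injective_range (Y : SimplexCategory) (S : Set (Fin (Y.len + 1)))
    (hS : S.Nonempty) : ∃ (X : SimplexCategory) (d : X ⟶ Y),
      Function.Injective d.toOrderHom ∧ Set.range d.toOrderHom = S := by
  classical
  have hc : S.toFinset.card = (S.toFinset.card - 1) + 1 := by
    have : 0 < S.toFinset.card := Finset.card_pos.2 (by simpa using hS)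
    omega
  refine ⟨mk (S.toFinset.card - 1), Hom.mk (S.toFinset.orderEmbOfFin hc).toOrderHom,
    (S.toFinset.orderEmbOfFin hc).injective, ?_⟩
  have := S.toFinset.range_orderEmbOfFin hc
  rw [Set.coe_toFinset] at this
  exact this

/-- Every arrow factors into a surjection followed by an injection. -/
theorem exists_image_factorization (f : X ⟶ Y) : ∃ (Z : SimplexCategory) (e : X ⟶ Z) (i : Z ⟶ Y),
    Function.Surjective e.toOrderHom ∧ Function.Injective i.toOrderHom ∧ e ≫ i = f := by
  obtain ⟨Z, i, hi, hr⟩ := exists_injective_range Y (Set.range f.toOrderHom) ⟨_, 0, rfl⟩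
  obtain ⟨e, he⟩ := exists_lift f i hi fun x => by
    have : f.toOrderHom x ∈ Set.range i.toOrderHom := hr ▸ Set.mem_range_self x
    exact this
  refine ⟨Z, e, i, fun z => ?_, hi, he⟩
  have hz : i.toOrderHom z ∈ Set.range f.toOrderHom := hr ▸ Set.mem_range_self z
  obtain ⟨x, hx⟩ := hz
  refine ⟨x, hi ?_⟩
  rw [← comp_apply, he, hx]

/-- The surjective monotone maps. -/
def surj : MorphismProperty SimplexCategory := fun _ _ f => Function.Surjective f.toOrderHom

/-- The injective monotone maps which preserve the minimum. -/
def minInj : MorphismProperty SimplexCategory :=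
  fun _ _ f => Function.Injective f.toOrderHom ∧ f.toOrderHom 0 = 0

theorem mon_surj_iff (f : X ⟶ Y) : Mon surj f ↔ Function.Injective f.toOrderHom := by
  constructor
  · intro h
    obtain ⟨Z, e, i, he, hi, rfl⟩ := exists_image_factorization f
    have : IsIso e := by
      by_contra hne
      exact h ⟨Z, e, i, he, hne, rfl⟩
    exact hi.comp ((isIso_iff_bijective e).1 this).1
  · rintro h ⟨Z, e, g, he, hne, rfl⟩
    exact hne ((isIso_iff_bijective e).2 ⟨Function.Injective.of_comp h, he⟩)

theorem sing_minInj_iff (f : X ⟶ Y) :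
    Sing minInj f ↔ ∃ y, y ≠ 0 ∧ ∀ x, f.toOrderHom x ≠ y := by
  constructor
  · rintro ⟨Z, g, h, ⟨hi, h0⟩, hne, rfl⟩
    rw [isIso_iff_bijective] at hne
    have : ¬ Function.Surjective h.toOrderHom := fun hs => hne ⟨hi, hs⟩
    rw [Function.Surjective] at this
    push Not at this
    obtain ⟨y, hy⟩ := this
    exact ⟨y, fun hy0 => hy 0 (h0.trans hy0.symm), fun x => hy _⟩
  · rintro ⟨y, hy0, hy⟩
    obtain ⟨Z, h, hi, hr⟩ := exists_injective_range Y {y}ᶜ ⟨0, hy0.symm⟩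
    have hmem : ∀ z, z ≠ y → ∃ w, h.toOrderHom w = z := fun z hz => by
      have : z ∈ Set.range h.toOrderHom := hr ▸ hz
      exact this
    obtain ⟨g, hg⟩ := exists_lift f h hi fun x => hmem _ (hy x)
    refine ⟨Z, g, h, ⟨hi, ?_⟩, fun hiso => ?_, hg.symm⟩
    · obtain ⟨w, hw⟩ := hmem 0 hy0.symm
      exact Fin.le_zero_iff.1 (hw ▸ h.toOrderHom.monotone (Fin.zero_le w))
    · have : y ∈ ({y}ᶜ : Set _) := hr ▸ ((isIso_iff_bijective h).1 hiso).2 y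
      exact this rfl

theorem regular_minInj_iff (f : X ⟶ Y) :
    Regular minInj f ↔ ∀ y, y ≠ 0 → ∃ x, f.toOrderHom x = y := by
  rw [Regular, sing_minInj_iff]
  push Not
  rfl

theorem nonempty_fact (f : X ⟶ Y) : Nonempty (Fact surj minInj f) := by
  obtain ⟨W, d, hd, hr⟩ :=
    exists_injective_range Y (insert 0 (Set.range f.toOrderHom)) ⟨0, Or.inl rfl⟩
  have hmem : ∀ y ∈ insert 0 (Set.range f.toOrderHom), ∃ w, d.toOrderHom w = y := by
    rw [← hr]
    exact fun y hy => hy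
  have hd0 : d.toOrderHom 0 = 0 := by
    obtain ⟨w, hw⟩ := hmem 0 (Or.inl rfl)
    exact Fin.le_zero_iff.1 (hw ▸ d.toOrderHom.monotone (Fin.zero_le w))
  obtain ⟨Z, e, i, he, hi, rfl⟩ := exists_image_factorization f
  obtain ⟨m, rfl⟩ := exists_lift i d hd fun z => by
    obtain ⟨x, rfl⟩ := he z
    exact hmem _ (Or.inr ⟨x, rfl⟩)
  refine ⟨⟨Z, W, e, m, d, he, ⟨(mon_surj_iff m).2 (Function.Injective.of_comp hi),
    (regular_minInj_iff m).2 fun w hw => ?_⟩, ⟨hd, hd0⟩, rfl⟩⟩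
  have hw' : d.toOrderHom w ∈ insert 0 (Set.range (e ≫ m ≫ d).toOrderHom) :=
    hr ▸ Set.mem_range_self w
  rcases hw' with h0 | ⟨x, hx⟩
  · exact absurd (hd (h0.trans hd0.symm)) hw
  · exact ⟨e.toOrderHom x, hd hx⟩

theorem Fact.range_d {f : X ⟶ Y} (F : Fact surj minInj f) :
    Set.range F.d.toOrderHom = insert 0 (Set.range f.toOrderHom) := by
  have hfac : ∀ x, f.toOrderHom x = F.d.toOrderHom (F.m.toOrderHom (F.e.toOrderHom x)) :=
    fun x => (apply_eq_of_eq F.fac x).symm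
  ext y
  constructor
  · rintro ⟨w, rfl⟩
    by_cases hw : w = 0
    · exact Or.inl (hw ▸ F.hd.2)
    · obtain ⟨z, rfl⟩ := (regular_minInj_iff F.m).1 F.hm.2 w hw
      obtain ⟨x, rfl⟩ := F.he z
      exact Or.inr ⟨x, hfac x⟩
  · rintro (rfl | ⟨x, rfl⟩)
    · exact ⟨0, F.hd.2⟩
    · exact ⟨_, (hfac x).symm⟩

theorem Fact.existsUnique_iso {f : X ⟶ Y} (F₁ F₂ : Fact surj minInj f) :
    ∃! p : (F₁.Z ≅ F₂.Z) × (F₁.W ≅ F₂.W),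
      F₁.e ≫ p.1.hom = F₂.e ∧ p.1.hom ≫ F₂.m = F₁.m ≫ p.2.hom ∧ p.2.hom ≫ F₂.d = F₁.d := by
  have hinj : ∀ F : Fact surj minInj f, Function.Injective (F.m ≫ F.d).toOrderHom := fun F =>
    F.hd.1.comp ((mon_surj_iff F.m).1 F.hm.1)
  obtain ⟨u, hu⟩ := exists_iso_of_comp_eq F₁.he (hinj F₁) F₂.he (hinj F₂)
    (F₁.fac.trans F₂.fac.symm)
  obtain ⟨v, hv⟩ := exists_iso_of_range_eq F₁.d F₂.d F₁.hd.1 F₂.hd.1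
    ((Fact.range_d F₁).trans (Fact.range_d F₂).symm)
  have : Epi F₁.e := epi_iff_surjective.2 F₁.he
  have : Mono F₂.d := mono_iff_injective.2 F₂.hd.1
  refine ⟨(u, v), ⟨hu, ?_, hv⟩, ?_⟩
  · rw [← cancel_mono F₂.d, ← cancel_epi F₁.e]
    simp only [Category.assoc]
    rw [hv, F₁.fac, reassoc_of% hu, F₂.fac]
  · rintro ⟨u', v'⟩ ⟨hu', -, hv'⟩
    refine Prod.ext (Iso.ext ?_) (Iso.ext ?_)
    · rw [← cancel_epi F₁.e]
      exact hu'.trans hu.symm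
    · rw [← cancel_mono F₂.d]
      exact hv'.trans hv.symm

/-- The arrows of `E^∨ ∘ E` are those which preserve the minimum. -/
theorem exists_surj_minInj_iff (f : X ⟶ Y) :
    (∃ (W : SimplexCategory) (e : X ⟶ W) (d : W ⟶ Y), surj e ∧ minInj d ∧ f = e ≫ d) ↔
      f.toOrderHom 0 = 0 := by
  constructor
  · rintro ⟨W, e, d, he, hd, rfl⟩
    rw [comp_apply, map_zero_of_surjective he, hd.2]
  · intro h
    obtain ⟨Z, e, i, he, hi, rfl⟩ := exists_image_factorization f
    refine ⟨Z, e, i, he, ⟨hi, ?_⟩, rfl⟩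
    rwa [comp_apply, map_zero_of_surjective he] at h

theorem sing_comp {f : X ⟶ Y} {g : Y ⟶ Z} (hf : Sing minInj f) (hg : Mon surj g) :
    Sing minInj (f ≫ g) := by
  rw [sing_minInj_iff] at hf ⊢
  rw [mon_surj_iff] at hg
  obtain ⟨y, hy0, hy⟩ := hf
  refine ⟨g.toOrderHom y, fun h0 => hy0 (hg ?_), fun x hx => hy x (hg hx)⟩
  rw [h0, eq_comm]
  exact Fin.le_zero_iff.1 (h0 ▸ g.toOrderHom.monotone (Fin.zero_le y))

/-- A surjection has a lower adjoint, which is a minimum-preserving section. -/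
theorem exists_lower_adjoint {e : X ⟶ Y} (he : Function.Surjective e.toOrderHom) :
    ∃ d : Y ⟶ X, minInj d ∧ d ≫ e = 𝟙 Y ∧ GaloisConnection d.toOrderHom e.toOrderHom := by
  classical
  have hne : ∀ c, (Finset.univ.filter fun x => c ≤ e.toOrderHom x).Nonempty := fun c => by
    obtain ⟨x, hx⟩ := he c
    exact ⟨x, by simp [hx]⟩
  let j : Fin (Y.len + 1) → Fin (X.len + 1) := fun c => Finset.min' _ (hne c)
  have hgc : GaloisConnection j e.toOrderHom := fun c x => by
    constructor
    · intro h
      have := Finset.min'_mem _ (hne c)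
      exact (Finset.mem_filter.1 this).2.trans (e.toOrderHom.monotone h)
    · intro h
      exact Finset.min'_le _ _ (by simpa using h)
  have hje : ∀ c, e.toOrderHom (j c) = c := fun c => by
    obtain ⟨x, rfl⟩ := he c
    exact hgc.u_l_u_eq_u x
  refine ⟨Hom.mk ⟨j, hgc.monotone_l⟩, ⟨?_, hgc.l_bot⟩, hom_ext_apply hje, hgc⟩
  exact Function.LeftInverse.injective (g := e.toOrderHom) hje

/-- A minimum-preserving injection is a section of a surjection to which it is lower adjoint. -/
theorem exists_upper_adjoint {d : Y ⟶ X} (hd : minInj d) :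
    ∃ e : X ⟶ Y, surj e ∧ d ≫ e = 𝟙 Y ∧ GaloisConnection d.toOrderHom e.toOrderHom := by
  classical
  have hs : StrictMono d.toOrderHom := d.toOrderHom.monotone.strictMono_of_injective hd.1
  have hne : ∀ x, (Finset.univ.filter fun c => d.toOrderHom c ≤ x).Nonempty := fun x =>
    ⟨0, by simp [hd.2]⟩
  let r : Fin (X.len + 1) → Fin (Y.len + 1) := fun x => Finset.max' _ (hne x)
  have hgc : GaloisConnection d.toOrderHom r := fun c x => by
    constructor
    · intro h
      exact Finset.le_max' _ _ (by simpa using h)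
    · intro h
      have := Finset.max'_mem _ (hne x)
      exact (d.toOrderHom.monotone h).trans (Finset.mem_filter.1 this).2
  have hr : ∀ c, r (d.toOrderHom c) = c := fun c => hd.1 (hgc.l_u_l_eq_l c)
  exact ⟨Hom.mk ⟨r, hgc.monotone_u⟩, fun c => ⟨_, hr c⟩, hom_ext_apply hr, hgc⟩

/-- Surjections are isomorphic if and only if their lower adjoints have the same range. -/
theorem epiEquiv_iff_range_eq {b : SimplexCategory} {e : b ⟶ X} {d : X ⟶ b}
    {e' : b ⟶ Y} {d' : Y ⟶ b} (he : surj e) (hd : minInj d) (he' : surj e') (hd' : minInj d')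
    (h : GaloisConnection d.toOrderHom e.toOrderHom)
    (h' : GaloisConnection d'.toOrderHom e'.toOrderHom) :
    EpiEquiv e e' ↔ Set.range d.toOrderHom = Set.range d'.toOrderHom := by
  constructor
  · rintro ⟨u, rfl⟩
    have hgc : GaloisConnection (u.inv ≫ d).toOrderHom (e ≫ u.hom).toOrderHom := fun c x => by
      have h1 : ∀ y, u.inv.toOrderHom (u.hom.toOrderHom y) = y :=
        apply_eq_of_eq u.hom_inv_id
      have h2 : ∀ y, u.hom.toOrderHom (u.inv.toOrderHom y) = y :=
        apply_eq_of_eq u.inv_hom_id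
      rw [comp_apply, comp_apply, h]
      exact ⟨fun hc => h2 c ▸ u.hom.toOrderHom.monotone hc,
        fun hc => by simpa only [h1] using u.inv.toOrderHom.monotone hc⟩
    have hfun := fun c => hgc.l_unique h' (fun _ => rfl) (b := c)
    have hsurj := ((isIso_iff_bijective u.inv).1 inferInstance).2
    rw [← hsurj.range_comp]
    exact congrArg Set.range (funext hfun)
  · intro hr
    obtain ⟨u, hu⟩ := exists_iso_of_range_eq d d' hd.1 hd'.1 hr
    refine exists_iso_of_comp_eq he hd.1 he' hd'.1 (hom_ext_apply fun x => ?_)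
    rw [comp_apply, comp_apply]
    have key : ∀ {P Q : SimplexCategory} {e : b ⟶ P} {d : P ⟶ b} {e' : b ⟶ Q} {d' : Q ⟶ b},
        GaloisConnection d.toOrderHom e.toOrderHom →
        GaloisConnection d'.toOrderHom e'.toOrderHom →
        Set.range d.toOrderHom = Set.range d'.toOrderHom →
        ∀ x, d.toOrderHom (e.toOrderHom x) ≤ d'.toOrderHom (e'.toOrderHom x) := by
      intro P Q e d e' d' h h' hr x
      obtain ⟨c, hc⟩ : d.toOrderHom (e.toOrderHom x) ∈ Set.range d'.toOrderHom :=
        hr ▸ Set.mem_range_self _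
      rw [← hc]
      exact d'.toOrderHom.monotone ((h' c x).1 (hc ▸ h.l_u_le x))
    exact le_antisymm (key h h' hr x) (key h' h hr.symm x)

theorem dualEquiv_iff_range_eq {d : X ⟶ Z} {d' : Y ⟶ Z} (hd : minInj d) (hd' : minInj d') :
    DualEquiv d d' ↔ Set.range d.toOrderHom = Set.range d'.toOrderHom := by
  refine ⟨?_, exists_iso_of_range_eq d d' hd.1 hd'.1⟩
  rintro ⟨u, rfl⟩
  exact ((isIso_iff_bijective u.hom).1 inferInstance).2.range_comp d'.toOrderHom

/-- The sum of the values of an arrow. -/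
def weight (d : X ⟶ Y) : ℕ := ∑ x, (d.toOrderHom x : ℕ)

/-- If `e` is right adjoint to `d'` and `e ∘ d` is invertible, then `d` dominates `d'` pointwise,
so it cannot have smaller weight unless both have the same range. -/
theorem range_eq_of_weight_le {b : SimplexCategory} {d : X ⟶ b} {d' : Y ⟶ b} {e : b ⟶ Y}
    (h : GaloisConnection d'.toOrderHom e.toOrderHom) (hiso : IsIso (d ≫ e))
    (hw : weight d ≤ weight d') : Set.range d.toOrderHom = Set.range d'.toOrderHom := by
  have hb := (isIso_iff_bijective _).1 hiso
  have hle : ∀ x ∈ Finset.univ, (d'.toOrderHom ((d ≫ e).toOrderHom x) : ℕ) ≤ d.toOrderHom x :=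
    fun x _ => h.l_u_le (d.toOrderHom x)
  have hsum : ∑ x, (d'.toOrderHom ((d ≫ e).toOrderHom x) : ℕ) = weight d' :=
    hb.sum_comp fun y => (d'.toOrderHom y : ℕ)
  have heq := (Finset.sum_eq_sum_iff_of_le hle).1
    (le_antisymm (Finset.sum_le_sum hle) (hsum ▸ hw))
  rw [← hb.2.range_comp]
  exact congrArg Set.range (funext fun x => (Fin.ext (heq x (Finset.mem_univ x))).symm)

theorem triangularAt (b : SimplexCategory) : TriangularAt surj minInj b := by
  classical
  let I := {S : Set (Fin (b.len + 1)) // (0 : Fin (b.len + 1)) ∈ S}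
  have hI : ∀ S : I, ∃ (X : SimplexCategory) (d : X ⟶ b),
      minInj d ∧ Set.range d.toOrderHom = S.1 := fun S => by
    obtain ⟨X, d, hd, hr⟩ := exists_injective_range b S.1 ⟨0, S.2⟩
    obtain ⟨x, hx⟩ : (0 : Fin (b.len + 1)) ∈ Set.range d.toOrderHom := hr ▸ S.2
    exact ⟨X, d, ⟨hd, Fin.le_zero_iff.1 (hx ▸ d.toOrderHom.monotone (Fin.zero_le x))⟩, hr⟩
  choose C d hd hr using hI
  choose e he hde hgc using fun S => exists_upper_adjoint (hd S)
  let σ₀ := (Fintype.equivFin I).symm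
  let σ : Fin (Fintype.card I) ≃ I :=
    (Tuple.sort fun i => weight (d (σ₀ i))).trans σ₀
  have hσ : Monotone fun i => weight (d (σ i)) :=
    Tuple.monotone_sort fun i => weight (d (σ₀ i))
  have hunique : ∀ {c : SimplexCategory} (f : c ⟶ b), minInj f →
      ∃! i, Set.range f.toOrderHom = Set.range (d (σ i)).toOrderHom := fun f hf => by
    refine ⟨σ.symm ⟨Set.range f.toOrderHom, 0, hf.2⟩, ?_, fun i hi => ?_⟩
    · simp [hr]
    · rw [Equiv.eq_symm_apply]
      exact Subtype.ext ((hr _).symm.trans hi.symm)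
  refine ⟨Fintype.card I, Fintype.card_pos_iff.2 ⟨⟨Set.univ, trivial⟩⟩, fun i => C (σ i),
    fun i => e (σ i), fun i => C (σ i), fun i => d (σ i), fun i => he _, fun i => hd _,
    fun f hf => ?_, fun f hf => ?_, fun i => ?_, fun i j hij hiso => hij.ne (σ.injective ?_)⟩
  · obtain ⟨g, hg, -, hfg⟩ := exists_lower_adjoint hf
    simp only [epiEquiv_iff_range_eq hf hg (he _) (hd _) hfg (hgc _)]
    exact hunique g hg
  · simp only [dualEquiv_iff_range_eq hf (hd _)]
    exact hunique f hf
  · rw [hde]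
    infer_instance
  · have := range_eq_of_weight_le (hgc (σ i)) hiso (hσ hij.le)
    rw [hr, hr] at this
    exact Subtype.ext this

/-- The DK-triple of the simplex category, the surjections and the minimum-preserving
injections. -/
def dkTriple : DKTriple SimplexCategory where
  E := surj
  Edual := minInj
  E_iso f hf := ((isIso_iff_bijective f).1 hf).2
  Edual_iso f hf :=
    ⟨((isIso_iff_bijective f).1 hf).1, map_zero_of_surjective ((isIso_iff_bijective f).1 hf).2⟩
  E_comp {_ _ _ f g} hf hg :=
    Function.Surjective.comp (g := g.toOrderHom) (f := f.toOrderHom) hg hf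
  Edual_comp hf hg := ⟨hg.1.comp hf.1, by rw [comp_apply, hf.2, hg.2]⟩
  t1_exists := nonempty_fact
  t1_unique := Fact.existsUnique_iso
  t2 := triangularAt
  t3 hf hg := by
    rw [exists_surj_minInj_iff] at hf hg ⊢
    rw [comp_apply, hf, hg]
  t4 hf hg := by
    rw [mon_surj_iff] at hf hg ⊢
    exact hg.1.comp hf.1
  t5 := sing_comp

end Simplex

/-- The simplex category `Δ`, equipped with `E` = the surjective monotone maps
and `E^∨` = the minimum-preserving injective monotone maps, is a DK-triple. -/
theorem simplexCategory_dkTriple :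
    ∃ T : DKTriple SimplexCategory,
      (∀ {X Y : SimplexCategory} (f : X ⟶ Y),
        T.E f ↔ Function.Surjective f.toOrderHom) ∧
      (∀ {X Y : SimplexCategory} (f : X ⟶ Y),
        T.Edual f ↔ (Function.Injective f.toOrderHom ∧ f.toOrderHom 0 = 0)) :=
  ⟨Simplex.dkTriple, fun _ => Iff.rfl, fun _ => Iff.rfl⟩

end DK
end
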